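/- Lemma F.3 (completion of a G-invariant symplectic intertwiner): Let G be a group and S : G → Matrix (2n×2n) ℝ a group homomorphism with every S(g) symplectic, and suppose there exists a covariance matrix σ (real symmetric with σ + i·Ω_n positive semidefinite as a complex matrix) with S(g) * σ * S(g)ᵀ = σ for all g ∈ G. Let F_in and F_out be linear subspaces of ℝ^{2n} such that: S(g) maps F_in into F_in and F_out into F_out for every g ∈ G; the bilinear form (u,v) ↦ uᵀ * Ω_n * v is nondegenerate on F_in and on F_out; and dim F_in = dim F_out. Let V : ℝ^{2n} → ℝ^{2n} be a linear map with V(F_in) ⊆ F_out, V(S(g)·x) = S(g)·(V x) for all x ∈ F_in and g ∈ G, and (V x)ᵀ * Ω_n * (V y) = xᵀ * Ω_n * y for all x, y ∈ F_in. Then there exists a (2n×2n) real matrix W that is symplectic, commutes with S(g) for every g ∈ G, and satisfies W·x = V·x for all x ∈ F_in. -/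

import Mathlib

open Matrix ComplexOrder

noncomputable section

/-- The 2×2 standard symplectic form `Ω₁ = !![0,1; -1,0]`. -/
def Omega1 : Matrix (Fin 2) (Fin 2) ℝ := !![0, 1; -1, 0]

/-- The 2n×2n standard symplectic form `Ω_n`, a block-diagonal matrix with `n` copies of `Ω₁`. -/
def OmegaN (n : ℕ) : Matrix (Fin 2 × Fin n) (Fin 2 × Fin n) ℝ :=
  Matrix.blockDiagonal fun _ => Omega1

/-- A real 2n×2n matrix is symplectic if `S * Ω_n * Sᵀ = Ω_n`. -/
def IsSymplectic {n : ℕ} (S : Matrix (Fin 2 × Fin n) (Fin 2 × Fin n) ℝ) : Prop :=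
  S * OmegaN n * Sᵀ = OmegaN n


lemma ic_split {R M : Type*} [Ring R] [AddCommGroup M] [Module R M] [IsSemisimpleModule R M]
    (N : Submodule R M) : Nonempty (M ≃ₗ[R] (M ⧸ N) × N) := by
  obtain ⟨q, hq⟩ := exists_isCompl N
  exact ⟨(Submodule.prodEquivOfIsCompl q N hq.symm).symm ≪≫ₗ
    (LinearEquiv.prodCongr (Submodule.quotientEquivOfIsCompl N q hq).symm (LinearEquiv.refl R N))⟩

lemma ic_coatom {R M : Type*} [Ring R] [AddCommGroup M] [Module R M] [IsSemisimpleModule R M]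
    (N N' : Submodule R M) (hN : IsCoatom N) (hN' : IsCoatom N')
    (e : (M ⧸ N) ≃ₗ[R] (M ⧸ N')) : Nonempty (N ≃ₗ[R] N') := by
  by_cases h : N = N'
  · subst h; exact ⟨LinearEquiv.refl R N⟩
  have key : ∀ (A B : Submodule R M), IsCoatom A → IsCoatom B → A ≠ B →
      Nonempty (A ≃ₗ[R] (M ⧸ B) × (A ⊓ B : Submodule R M)) := by
    intro A B hA hB hAB
    have hsup : A ⊔ B = ⊤ := hA.sup_eq_top_of_ne hB hAB
    obtain ⟨f⟩ := ic_split (Submodule.comap A.subtype (A ⊓ B))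
    let g1 := LinearMap.quotientInfEquivSupQuotient A B
    let g2 : (↥(A ⊔ B) ⧸ Submodule.comap (A ⊔ B).subtype B) ≃ₗ[R] M ⧸ B :=
      Submodule.Quotient.equiv _ _ (LinearEquiv.ofTop (A ⊔ B) hsup) (by
        rw [Submodule.map_equiv_eq_comap_symm]
        ext x
        simp)
    let g3 : (Submodule.comap A.subtype (A ⊓ B)) ≃ₗ[R] (A ⊓ B : Submodule R M) :=
      Submodule.comapSubtypeEquivOfLe inf_le_left
    exact ⟨f ≪≫ₗ LinearEquiv.prodCongr (g1 ≪≫ₗ g2) g3⟩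
  obtain ⟨f⟩ := key N N' hN hN' h
  obtain ⟨f'⟩ := key N' N hN' hN (Ne.symm h)
  exact ⟨f ≪≫ₗ LinearEquiv.prodCongr e.symm
    (LinearEquiv.ofEq _ _ (inf_comm _ _)) ≪≫ₗ f'.symm⟩

lemma ic_prod_ss (R A B : Type*) [Ring R] [AddCommGroup A] [Module R A]
    [AddCommGroup B] [Module R B] [IsSemisimpleModule R A] [IsSemisimpleModule R B] :
    IsSemisimpleModule R (A × B) := by
  have h1 : IsSemisimpleModule R (LinearMap.range (LinearMap.inl R A B)) := .range _
  have h2 : IsSemisimpleModule R (LinearMap.range (LinearMap.inr R A B)) := .range _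
  have h3 := IsSemisimpleModule.sup h1 h2
  rw [LinearMap.sup_range_inl_inr] at h3
  exact IsSemisimpleModule.congr (Submodule.topEquiv (R := R) (M := A × B)).symm

lemma ic_cancel_simple {R A B C : Type*} [Ring R] [AddCommGroup A] [Module R A]
    [AddCommGroup B] [Module R B] [AddCommGroup C] [Module R C]
    [IsSimpleModule R A] [IsSemisimpleModule R B] [IsSemisimpleModule R C]
    (e : (A × B) ≃ₗ[R] (A × C)) : Nonempty (B ≃ₗ[R] C) := by
  have := ic_prod_ss R A C
  let p : (A × C) →ₗ[R] A := LinearMap.fst R A C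
  let q : (A × C) →ₗ[R] A := LinearMap.fst R A B ∘ₗ e.symm.toLinearMap
  have hp : Function.Surjective p := LinearMap.fst_surjective
  have hq : Function.Surjective q := (LinearMap.fst_surjective (R := R)).comp e.symm.surjective
  obtain ⟨f⟩ := ic_coatom (LinearMap.ker q) (LinearMap.ker p)
    (LinearMap.isCoatom_ker_of_surjective hq)
    (LinearMap.isCoatom_ker_of_surjective hp)
    ((q.quotKerEquivOfSurjective hq) ≪≫ₗ (p.quotKerEquivOfSurjective hp).symm)
  let b : B ≃ₗ[R] LinearMap.ker q := LinearEquiv.ofBijective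
    (LinearMap.codRestrict (LinearMap.ker q) (e.toLinearMap ∘ₗ LinearMap.inr R A B)
      (fun x => by simp [q])) ⟨fun x y h => by
        have h1 : e (0, x) = e (0, y) := congrArg Subtype.val h
        simpa using h1, fun ⟨y, hy⟩ => ⟨(e.symm y).2, by
          ext1
          have h0 : (e.symm y).1 = 0 := hy
          have : ((0 : A), (e.symm y).2) = e.symm y := Prod.ext h0.symm rfl
          change e (0, (e.symm y).2) = y
          rw [this, LinearEquiv.apply_symm_apply]⟩⟩
  let c : C ≃ₗ[R] LinearMap.ker p := LinearEquiv.ofBijective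
    (LinearMap.codRestrict (LinearMap.ker p) (LinearMap.inr R A C)
      (fun x => by simp [p])) ⟨fun x y h => by
        have h1 : ((0 : A), x) = (0, y) := congrArg Subtype.val h
        simpa using h1, fun ⟨y, hy⟩ => ⟨y.2, by
          ext1
          have h0 : y.1 = 0 := hy
          exact Prod.ext h0.symm rfl⟩⟩
  exact ⟨b ≪≫ₗ f ≪≫ₗ c.symm⟩

lemma ic_cancel {R : Type*} [Ring R] {B C : Type*}
    [AddCommGroup B] [Module R B] [AddCommGroup C] [Module R C]
    [IsSemisimpleModule R B] [IsSemisimpleModule R C]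
    {A : Type*} [AddCommGroup A] [Module R A] (hA : IsFiniteLength R A)
    [IsSemisimpleModule R A]
    (e : (A × B) ≃ₗ[R] (A × C)) : Nonempty (B ≃ₗ[R] C) := by
  revert e
  rename_i h
  revert h
  induction hA with
  | @of_subsingleton M _ _ _ =>
    intro _ e
    have : Unique M := ⟨⟨0⟩, fun x => Subsingleton.elim _ _⟩
    exact ⟨(LinearEquiv.uniqueProd (R := R)).symm ≪≫ₗ e ≪≫ₗ LinearEquiv.uniqueProd⟩
  | @of_simple_quotient M _ _ N _ hN ih =>
    intro _ e
    obtain ⟨f⟩ := ic_split N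
    have e' := (LinearEquiv.prodAssoc R (M ⧸ N) N B).symm ≪≫ₗ
      (LinearEquiv.prodCongr f (LinearEquiv.refl R B)).symm ≪≫ₗ e ≪≫ₗ
      (LinearEquiv.prodCongr f (LinearEquiv.refl R C)) ≪≫ₗ (LinearEquiv.prodAssoc R (M ⧸ N) N C)
    have := ic_prod_ss R N B
    have := ic_prod_ss R N C
    obtain ⟨e''⟩ := ic_cancel_simple e'
    exact ih e''

lemma ic_root {E : Type*} [AddCommGroup E] [Module ℝ E] [FiniteDimensional ℝ E]
    (P : E →ₗ[ℝ] E →ₗ[ℝ] ℝ) (hsymm : ∀ x y, P x y = P y x) (hpos : ∀ x, x ≠ 0 → 0 < P x x)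
    (T : Module.End ℝ E) (hT : ∀ x y, P x (T y) = P (T x) y)
    (hTpos : ∀ x, x ≠ 0 → 0 < P x (T x)) :
    ∃ Q : Module.End ℝ E, (∀ x, T (Q (Q (Q (Q x)))) = x) ∧ (∀ U, Commute U T → Commute U Q) ∧
      (∀ x y, P x (Q y) = P (Q x) y) := by
  let core : InnerProductSpace.Core ℝ E :=
    { inner := fun x y => P x y
      conj_inner_symm := fun x y => by simp [hsymm x y]
      re_inner_nonneg := fun x => by
        by_cases h : x = 0
        · simp [h]
        · exact (hpos x h).le
      add_left := fun x y z => by simp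
      smul_left := fun x y r => by simp
      definite := fun x hx => by
        by_contra h
        exact (hpos x h).ne' hx }
  let : NormedAddCommGroup E := core.toNormedAddCommGroup
  let : InnerProductSpace ℝ E := InnerProductSpace.ofCore core.toCore
  have hinner : ∀ x y : E, inner ℝ x y = P x y := fun x y => rfl
  have hTs : T.IsSymmetric := fun x y => (hT x y).symm
  let b := hTs.eigenvectorBasis rfl
  let ev := hTs.eigenvalues rfl
  have hTb : ∀ i, T (b i) = ev i • b i := fun i => hTs.apply_eigenvectorBasis rfl i
  have hev : ∀ i, 0 < ev i := by
    intro i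
    have hb : b i ≠ 0 := b.orthonormal.ne_zero i
    have h1 := hTpos _ hb
    rw [hTb, map_smul, smul_eq_mul] at h1
    exact pos_of_mul_pos_left h1 (hpos _ hb).le
  let r : ℝ → ℝ := fun t => (Real.sqrt (Real.sqrt t))⁻¹
  let p : Polynomial ℝ := Lagrange.interpolate (Finset.univ.image ev) id r
  have hp : ∀ i, p.eval (ev i) = r (ev i) := fun i =>
    Lagrange.eval_interpolate_at_node (v := id) r (Set.injOn_id _)
      (Finset.mem_image_of_mem _ (Finset.mem_univ i))
  have hQb : ∀ i, (Polynomial.aeval T p) (b i) = r (ev i) • b i := by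
    intro i
    rw [← hp i]
    exact Module.End.aeval_apply_of_hasEigenvector
      (hTs.hasEigenvector_eigenvectorBasis rfl i)
  refine ⟨Polynomial.aeval T p, ?_, ?_, ?_⟩
  · intro x
    have : T ∘ₗ (Polynomial.aeval T p) ∘ₗ (Polynomial.aeval T p) ∘ₗ (Polynomial.aeval T p) ∘ₗ
      (Polynomial.aeval T p) = LinearMap.id := by
      refine b.toBasis.ext fun i => ?_
      simp only [OrthonormalBasis.coe_toBasis, LinearMap.comp_apply, hQb, map_smul, hTb,
        LinearMap.id_apply, smul_smul]
      have h4 : r (ev i) * (r (ev i) * (r (ev i) * (r (ev i) * ev i))) = 1 := by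
        have h1 := Real.sq_sqrt (hev i).le
        have h2 := Real.sq_sqrt (Real.sqrt_nonneg (ev i))
        have h3 : 0 < Real.sqrt (Real.sqrt (ev i)) := Real.sqrt_pos.2 (Real.sqrt_pos.2 (hev i))
        simp only [r]
        field_simp
        nlinarith
      simp [mul_assoc, h4]
    exact LinearMap.congr_fun this x
  · intro U hU
    induction p using Polynomial.induction_on' with
    | add p q hp hq => simpa using hp.add_right hq
    | monomial n a =>
      rw [Polynomial.aeval_monomial]
      exact Commute.mul_right (Algebra.commutes a U).symm (hU.pow_right n) 
  · have key : ∀ q : Polynomial ℝ, ∀ x y,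
        P x (Polynomial.aeval T q y) = P (Polynomial.aeval T q x) y := by
      intro q
      induction q using Polynomial.induction_on' with
      | add p q hp hq => intro x y; simp [hp, hq]
      | monomial n a =>
        have hn : ∀ x y, P x ((T ^ n) y) = P ((T ^ n) x) y := by
          induction n with
          | zero => simp
          | succ n ih => intro x y; rw [pow_succ, Module.End.mul_apply, ih, hT, ← Module.End.mul_apply, ← pow_succ', pow_succ]
        intro x y
        simp [Polynomial.aeval_monomial, hn]
    exact key p

lemma ic_riesz {E : Type*} [AddCommGroup E] [Module ℝ E] [FiniteDimensional ℝ E]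
    (P : E →ₗ[ℝ] E →ₗ[ℝ] ℝ) (hpos : ∀ x, x ≠ 0 → 0 < P x x)
    (L : E →ₗ[ℝ] E →ₗ[ℝ] ℝ) : ∃ K : Module.End ℝ E, ∀ x y, P x (K y) = L x y := by
  have hinj : Function.Injective P.flip := by
    rw [injective_iff_map_eq_zero]
    intro x hx
    by_contra h
    have := LinearMap.congr_fun hx x
    rw [LinearMap.flip_apply] at this
    exact (hpos x h).ne' this
  let eq := LinearMap.linearEquivOfInjective P.flip hinj (Subspace.dual_finrank_eq).symm
  refine ⟨eq.symm.toLinearMap ∘ₗ L.flip, fun x y => ?_⟩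
  have h : eq (eq.symm (L.flip y)) = L.flip y := LinearEquiv.apply_symm_apply _ _
  have h2 := LinearMap.congr_fun h x
  exact h2

/-- a symplectic representation with an invariant positive form -/
structure ICRep (G : Type*) [Group G] (E : Type*) [AddCommGroup E] [Module ℝ E] where
  om : E →ₗ[ℝ] E →ₗ[ℝ] ℝ
  P : E →ₗ[ℝ] E →ₗ[ℝ] ℝ
  rho : G → Module.End ℝ E
  alt : ∀ x y, om x y = - om y x
  nondeg : ∀ y, (∀ x, om x y = 0) → y = 0
  symm : ∀ x y, P x y = P y x
  pos : ∀ x, x ≠ 0 → 0 < P x x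
  adjOm : ∀ g x y, om x (rho g y) = om (rho g⁻¹ x) y
  adjP : ∀ g x y, P x (rho g y) = P (rho g⁻¹ x) y

lemma ic_ext {E : Type*} [AddCommGroup E] [Module ℝ E]
    (P : E →ₗ[ℝ] E →ₗ[ℝ] ℝ) (hpos : ∀ x, x ≠ 0 → 0 < P x x) {a b : E}
    (h : ∀ x, P x a = P x b) : a = b := by
  by_contra hab
  have h1 := hpos (a - b) (sub_ne_zero.2 hab)
  rw [map_sub (P (a - b)), h, sub_self] at h1
  exact lt_irrefl _ h1

lemma ic_J {G : Type*} [Group G] {E : Type*} [AddCommGroup E] [Module ℝ E]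
    [FiniteDimensional ℝ E] (D : ICRep G E) :
    ∃ J : Module.End ℝ E, (∀ x, J (J x) = -x) ∧ (∀ x y, D.om x (J y) = - D.om (J x) y) ∧
      (∀ x, x ≠ 0 → 0 < D.om x (J x)) ∧ (∀ g x, J (D.rho g x) = D.rho g (J x)) ∧
      (∀ x y, D.P x (J y) = - D.P (J x) y) := by
  obtain ⟨K, hK⟩ := ic_riesz D.P D.pos D.om
  have hKskew : ∀ x y, D.P x (K y) = - D.P (K x) y := by
    intro x y
    rw [hK, D.alt, ← hK, D.symm]
  have hKinj : ∀ x, x ≠ 0 → K x ≠ 0 := by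
    intro x hx h
    apply hx
    apply D.nondeg
    intro y
    rw [← hK, h, map_zero]
  obtain ⟨Q, hQ1, hQ2, hQ3⟩ := ic_root D.P D.symm D.pos (-(K * K))
    (fun x y => by simp [hKskew])
    (fun x hx => by
      have h : D.P x ((-(K * K)) x) = D.P (K x) (K x) := by
        simp [hKskew x (K x)]
      rw [h]
      exact D.pos _ (hKinj x hx))
  have hKQ : ∀ x, K (Q x) = Q (K x) := by
    intro x
    have h : Commute K (-(K * K)) := by
      rw [Commute, SemiconjBy]; simp [mul_assoc]
    exact LinearMap.congr_fun (hQ2 K h).eq x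
  have hQinj : ∀ x, x ≠ 0 → Q x ≠ 0 := by
    intro x hx h
    apply hx
    rw [← hQ1 x, h]
    simp
  have hg : ∀ g x, K (D.rho g x) = D.rho g (K x) := by
    intro g x
    apply ic_ext D.P D.pos
    intro y
    rw [hK, D.adjOm, ← hK, D.adjP]
  have hQg : ∀ g x, Q (D.rho g x) = D.rho g (Q x) := by
    intro g x
    have h : Commute (D.rho g) (-(K * K)) := by
      ext y
      simp [hg]
    exact (LinearMap.congr_fun (hQ2 _ h).eq x).symm
  refine ⟨-(K * (Q * Q)), ?_, ?_, ?_, ?_, ?_⟩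
  · intro x
    have := hQ1 x
    simp only [LinearMap.neg_apply, Module.End.mul_apply, map_neg, neg_neg, ← hKQ] at this ⊢
    rw [← this, neg_neg, this]
  · intro x y
    simp only [LinearMap.neg_apply, Module.End.mul_apply, map_neg, ← hK, neg_neg, hKskew, hQ3, hKQ]
  · intro x hx
    have h : D.om x ((-(K * (Q * Q))) x) = D.P (Q (K x)) (Q (K x)) := by
      simp only [LinearMap.neg_apply, Module.End.mul_apply, map_neg, ← hK]
      rw [hKskew x, hKQ, hKQ, hQ3, neg_neg]
    rw [h]
    exact D.pos _ (hQinj _ (hKinj _ hx))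
  · intro g x
    simp [hg, hQg]
  · intro x y
    simp only [LinearMap.neg_apply, Module.End.mul_apply, map_neg, neg_neg, hKskew, hQ3, hKQ]

lemma ic_mod_aux {I E : Type*} [AddCommGroup E] [Module ℝ E] [FiniteDimensional ℝ E]
    (f : I → Module.End ℝ E) (P : E →ₗ[ℝ] E →ₗ[ℝ] ℝ) (hsymm : ∀ x y, P x y = P y x)
    (hpos : ∀ x, x ≠ 0 → 0 < P x x)
    (t : I → I) (c : I → ℝ) (hf : ∀ i x y, P x (f i y) = c i * P (f (t i) x) y)
    [Module (FreeAlgebra ℝ I) E]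
    (hsm : ∀ (r : FreeAlgebra ℝ I) (x : E), r • x = FreeAlgebra.lift ℝ f r x) :
    IsFiniteLength (FreeAlgebra ℝ I) E ∧ IsSemisimpleModule (FreeAlgebra ℝ I) E := by
  have : IsScalarTower ℝ (FreeAlgebra ℝ I) E := ⟨fun a r x => by simp [hsm]⟩
  refine ⟨isFiniteLength_iff_isNoetherian_isArtinian.2
    ⟨isNoetherian_of_tower ℝ inferInstance, isArtinian_of_tower ℝ inferInstance⟩, ?_⟩
  refine (isSemisimpleModule_iff _ _).2 ⟨fun N => ?_⟩
  let N' : Submodule (FreeAlgebra ℝ I) E :=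
    { carrier := {y | ∀ x ∈ N, P x y = 0}
      add_mem' := fun {a b} ha hb x hx => by simp [ha x hx, hb x hx]
      zero_mem' := fun x hx => by simp
      smul_mem' := fun r y hy => by
        simp only [hsm]
        induction r generalizing y with
        | grade0 r => intro x hx; simp [hy x hx]
        | grade1 i =>
          intro x hx
          have h1 : f (t i) x ∈ N := by
            have := N.smul_mem (FreeAlgebra.ι ℝ (t i)) hx
            simpa [hsm] using this
          simp [hf, hy _ h1]
        | mul a b ha hb =>
          rw [map_mul]
          exact ha _ (hb _ hy)
        | add a b ha hb =>
          intro x hx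
          simp [ha y hy x hx, hb y hy x hx] }
  refine ⟨N', ?_, ?_⟩
  · rw [Submodule.disjoint_def]
    intro x hx hx'
    by_contra h
    exact (hpos x h).ne' (hx' x hx)
  · rw [codisjoint_iff, eq_top_iff]
    intro z _
    let NR : Submodule ℝ E := N.restrictScalars ℝ
    have hposN : ∀ x : NR, x ≠ 0 → 0 < P.domRestrict₁₂ NR NR x x := fun x hx =>
      hpos x (by simpa using hx)
    have hinj : Function.Injective (P.domRestrict₁₂ NR NR).flip := by
      rw [injective_iff_map_eq_zero]
      intro x hx
      by_contra h
      have := LinearMap.congr_fun hx x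
      rw [LinearMap.flip_apply] at this
      exact (hposN x h).ne' this
    let eq := LinearMap.linearEquivOfInjective _ hinj (Subspace.dual_finrank_eq).symm
    let w : NR := eq.symm ((P.flip z) ∘ₗ NR.subtype)
    have hw : ∀ x ∈ N, P x w = P x z := by
      intro x hx
      have h : eq w = (P.flip z) ∘ₗ NR.subtype := LinearEquiv.apply_symm_apply _ _
      exact LinearMap.congr_fun h ⟨x, hx⟩
    have : z = (w : E) + (z - w) := by abel
    rw [this]
    refine Submodule.add_mem_sup w.2 ?_
    intro x hx
    rw [map_sub, hw x hx, sub_self]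

lemma ic_lin_of_commute {I E F : Type*} [AddCommGroup E] [Module ℝ E] [AddCommGroup F] [Module ℝ F]
    (f : I → Module.End ℝ E) (f' : I → Module.End ℝ F) (e : E →ₗ[ℝ] F)
    (h : ∀ i x, e (f i x) = f' i (e x)) (r : FreeAlgebra ℝ I) (x : E) :
    e (FreeAlgebra.lift ℝ f r x) = FreeAlgebra.lift ℝ f' r (e x) := by
  induction r generalizing x with
  | grade0 r => simp
  | grade1 i => simp [h]
  | mul a b ha hb => simp [ha, hb]
  | add a b ha hb => simp [ha, hb]

lemma ic_lift_prod {I A D : Type*} [AddCommGroup A] [Module ℝ A]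
    [AddCommGroup D] [Module ℝ D] (fA : I → Module.End ℝ A) (fD : I → Module.End ℝ D)
    (r : FreeAlgebra ℝ I) (x : A × D) :
    FreeAlgebra.lift ℝ (fun i => ((fA i).prodMap (fD i) : Module.End ℝ (A × D))) r x =
      (FreeAlgebra.lift ℝ fA r x.1, FreeAlgebra.lift ℝ fD r x.2) :=
  Prod.ext (ic_lin_of_commute _ fA (LinearMap.fst ℝ A D) (fun _ _ => rfl) r x)
    (ic_lin_of_commute _ fD (LinearMap.snd ℝ A D) (fun _ _ => rfl) r x)

lemma ic_cancel_ops {I A B C : Type*} [AddCommGroup A] [Module ℝ A] [FiniteDimensional ℝ A]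
    [AddCommGroup B] [Module ℝ B] [FiniteDimensional ℝ B]
    [AddCommGroup C] [Module ℝ C] [FiniteDimensional ℝ C]
    (t : I → I) (c : I → ℝ)
    (fA : I → Module.End ℝ A) (PA : A →ₗ[ℝ] A →ₗ[ℝ] ℝ) (hsymmA : ∀ x y, PA x y = PA y x)
    (hposA : ∀ x, x ≠ 0 → 0 < PA x x)
    (hfA : ∀ i x y, PA x (fA i y) = c i * PA (fA (t i) x) y)
    (fB : I → Module.End ℝ B) (PB : B →ₗ[ℝ] B →ₗ[ℝ] ℝ) (hsymmB : ∀ x y, PB x y = PB y x)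
    (hposB : ∀ x, x ≠ 0 → 0 < PB x x)
    (hfB : ∀ i x y, PB x (fB i y) = c i * PB (fB (t i) x) y)
    (fC : I → Module.End ℝ C) (PC : C →ₗ[ℝ] C →ₗ[ℝ] ℝ) (hsymmC : ∀ x y, PC x y = PC y x)
    (hposC : ∀ x, x ≠ 0 → 0 < PC x x)
    (hfC : ∀ i x y, PC x (fC i y) = c i * PC (fC (t i) x) y)
    (e : (A × B) →ₗ[ℝ] (A × C)) (hbij : Function.Bijective e)
    (he : ∀ i x, e ((fA i).prodMap (fB i) x) = (fA i).prodMap (fC i) (e x)) :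
    ∃ d : B ≃ₗ[ℝ] C, ∀ i x, d (fB i x) = fC i (d x) := by
  let mA : Module (FreeAlgebra ℝ I) A := Module.compHom A (FreeAlgebra.lift ℝ fA).toRingHom
  let mB : Module (FreeAlgebra ℝ I) B := Module.compHom B (FreeAlgebra.lift ℝ fB).toRingHom
  let mC : Module (FreeAlgebra ℝ I) C := Module.compHom C (FreeAlgebra.lift ℝ fC).toRingHom
  have sA : ∀ (r : FreeAlgebra ℝ I) (x : A), r • x = FreeAlgebra.lift ℝ fA r x := fun _ _ => rfl
  have sB : ∀ (r : FreeAlgebra ℝ I) (x : B), r • x = FreeAlgebra.lift ℝ fB r x := fun _ _ => rfl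
  have sC : ∀ (r : FreeAlgebra ℝ I) (x : C), r • x = FreeAlgebra.lift ℝ fC r x := fun _ _ => rfl
  obtain ⟨lA, ssA⟩ := ic_mod_aux fA PA hsymmA hposA t c hfA sA
  obtain ⟨lB, ssB⟩ := ic_mod_aux fB PB hsymmB hposB t c hfB sB
  obtain ⟨lC, ssC⟩ := ic_mod_aux fC PC hsymmC hposC t c hfC sC
  let e' : (A × B) →ₗ[FreeAlgebra ℝ I] (A × C) :=
    { toFun := e
      map_add' := map_add e
      map_smul' := fun r x => by
        have h1 := ic_lin_of_commute
          (fun i => ((fA i).prodMap (fB i) : Module.End ℝ (A × B)))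
          (fun i => ((fA i).prodMap (fC i) : Module.End ℝ (A × C))) e he r x
        rw [ic_lift_prod, ic_lift_prod] at h1
        exact h1 }
  obtain ⟨d⟩ := ic_cancel lA (LinearEquiv.ofBijective e' hbij)
  refine ⟨{ d with map_smul' := fun a x => ?_ }, fun i x => ?_⟩
  · have := d.map_smul (algebraMap ℝ _ a) x
    rw [sB, sC] at this
    simpa using this
  · have := d.map_smul (FreeAlgebra.ι ℝ i) x
    rw [sB, sC] at this
    simpa using this

lemma ic_polar {G : Type*} [Group G] {B C : Type*}
    [AddCommGroup B] [Module ℝ B] [FiniteDimensional ℝ B]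
    [AddCommGroup C] [Module ℝ C]
    (DB : ICRep G B) (DC : ICRep G C)
    (JB : Module.End ℝ B) (JC : Module.End ℝ C)
    (hB1 : ∀ x, JB (JB x) = -x) (hB2 : ∀ x y, DB.om x (JB y) = - DB.om (JB x) y)
    (hB3 : ∀ x, x ≠ 0 → 0 < DB.om x (JB x)) (hB4 : ∀ g x, JB (DB.rho g x) = DB.rho g (JB x))
    (hC2 : ∀ x y, DC.om x (JC y) = - DC.om (JC x) y)
    (hC3 : ∀ x, x ≠ 0 → 0 < DC.om x (JC x)) (hC4 : ∀ g x, JC (DC.rho g x) = DC.rho g (JC x))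
    (d : B ≃ₗ[ℝ] C) (hdJ : ∀ x, d (JB x) = JC (d x))
    (hdg : ∀ g x, d (DB.rho g x) = DC.rho g (d x)) :
    ∃ ψ : B →ₗ[ℝ] C, (∀ x y, DC.om (ψ x) (ψ y) = DB.om x y) ∧
      ∀ g x, ψ (DB.rho g x) = DC.rho g (ψ x) := by
  let hb : B →ₗ[ℝ] B →ₗ[ℝ] ℝ := DB.om.compl₂ JB
  let hc : C →ₗ[ℝ] C →ₗ[ℝ] ℝ := DC.om.compl₂ JC
  have ehb : ∀ x y, hb x y = DB.om x (JB y) := fun _ _ => rfl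
  have ehc : ∀ x y, hc x y = DC.om x (JC y) := fun _ _ => rfl
  have sb : ∀ x y, hb x y = hb y x := fun x y => by
    rw [ehb, ehb, hB2, DB.alt, neg_neg]
  have sc : ∀ x y, hc x y = hc y x := fun x y => by
    rw [ehc, ehc, hC2, DC.alt, neg_neg]
  have gb : ∀ g x y, hb x (DB.rho g y) = hb (DB.rho g⁻¹ x) y := fun g x y => by
    rw [ehb, ehb, hB4, DB.adjOm]
  have gc : ∀ g x y, hc x (DC.rho g y) = hc (DC.rho g⁻¹ x) y := fun g x y => by
    rw [ehc, ehc, hC4, DC.adjOm]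
  have jb : ∀ x y, hb x (JB y) = - hb (JB x) y := fun x y => by
    rw [ehb, ehb, hB2]
  have jc : ∀ x y, hc x (JC y) = - hc (JC x) y := fun x y => by
    rw [ehc, ehc, hC2]
  obtain ⟨T, hT⟩ := ic_riesz hb hB3 (hc.compl₁₂ d.toLinearMap d.toLinearMap)
  have hT' : ∀ x y, hb x (T y) = hc (d x) (d y) := hT
  obtain ⟨Q, hQ1, hQ2, hQ3⟩ := ic_root hb sb hB3 T
    (fun x y => by rw [sb (T x), hT', hT', sc])
    (fun x hx => by rw [hT']; exact hC3 _ (by simpa using hx))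
  have hTJ : Commute JB T := by
    ext x
    apply ic_ext hb hB3
    intro y
    simp only [Module.End.mul_apply]
    rw [jb, hT', hT', hdJ, hdJ, jc]
  have hTg : ∀ g, Commute (DB.rho g) T := by
    intro g
    ext x
    apply ic_ext hb hB3
    intro y
    simp only [Module.End.mul_apply]
    rw [gb, hT', hT', hdg, hdg, gc]
  have hQT : ∀ x, T (Q x) = Q (T x) := fun x => LinearMap.congr_fun (hQ2 T rfl).eq x
  have hQJ : ∀ x, JB (Q x) = Q (JB x) := fun x => LinearMap.congr_fun (hQ2 _ hTJ).eq x
  have hQg : ∀ g x, DB.rho g (Q x) = Q (DB.rho g x) :=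
    fun g x => LinearMap.congr_fun (hQ2 _ (hTg g)).eq x
  refine ⟨d.toLinearMap ∘ₗ Q ∘ₗ Q, fun x y => ?_, fun g x => ?_⟩
  · have h1 : hc (d (Q (Q x))) (d (Q (Q (JB y)))) = hb x (JB y) := by
      rw [← hT', ← hQ3, ← hQ3, ← hQT, ← hQT, hQ1]
    rw [← hQJ, ← hQJ, hdJ, ehc, ehb, hB1] at h1
    have h2 : JC (JC (d (Q (Q y)))) = - d (Q (Q y)) := by
      rw [← hdJ, ← hdJ, hB1, map_neg]
    rw [h2, map_neg, map_neg, neg_inj] at h1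
    exact h1
  · simp [← hQg, hdg]

lemma ic_main {G : Type*} [Group G] {A B C : Type*}
    [AddCommGroup A] [Module ℝ A] [FiniteDimensional ℝ A]
    [AddCommGroup B] [Module ℝ B] [FiniteDimensional ℝ B]
    [AddCommGroup C] [Module ℝ C] [FiniteDimensional ℝ C]
    (DA : ICRep G A) (DB : ICRep G B) (DC : ICRep G C)
    (Φ : (A × B) ≃ₗ[ℝ] (A × C))
    (hΦ : ∀ x y, DA.om (Φ x).1 (Φ y).1 + DC.om (Φ x).2 (Φ y).2
      = DA.om x.1 y.1 + DB.om x.2 y.2)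
    (hΦg : ∀ g x, Φ (DA.rho g x.1, DB.rho g x.2) = (DA.rho g (Φ x).1, DC.rho g (Φ x).2)) :
    ∃ ψ : B →ₗ[ℝ] C, (∀ x y, DC.om (ψ x) (ψ y) = DB.om x y) ∧
      ∀ g x, ψ (DB.rho g x) = DC.rho g (ψ x) := by
  obtain ⟨JA, hA1, hA2, hA3, hA4, hA5⟩ := ic_J DA
  obtain ⟨JB, hB1, hB2, hB3, hB4, hB5⟩ := ic_J DB
  obtain ⟨JC, hC1, hC2, hC3, hC4, hC5⟩ := ic_J DC
  let J1 : Module.End ℝ (A × B) := JA.prodMap JB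
  let J2 : Module.End ℝ (A × C) := JA.prodMap JC
  have hJ1 : ∀ x, J1 (J1 x) = -x := fun x => Prod.ext (hA1 _) (hB1 _)
  have hJ2 : ∀ x, J2 (J2 x) = -x := fun x => Prod.ext (hA1 _) (hC1 _)
  let T0 : (A × B) →ₗ[ℝ] (A × C) := Φ.toLinearMap - J2 ∘ₗ Φ.toLinearMap ∘ₗ J1
  have hT0 : ∀ x, T0 x = Φ x - J2 (Φ (J1 x)) := fun _ => rfl
  have nnA : ∀ x, 0 ≤ DA.om x (JA x) := fun x => by
    by_cases h : x = 0
    · simp [h]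
    · exact (hA3 x h).le
  have nnB : ∀ x, 0 ≤ DB.om x (JB x) := fun x => by
    by_cases h : x = 0
    · simp [h]
    · exact (hB3 x h).le
  have nnC : ∀ x, 0 ≤ DC.om x (JC x) := fun x => by
    by_cases h : x = 0
    · simp [h]
    · exact (hC3 x h).le
  have hinj : Function.Injective T0 := by
    rw [injective_iff_map_eq_zero]
    intro x hx
    have h1 : J2 (Φ x) + Φ (J1 x) = 0 := by
      have := congrArg J2 hx
      rw [hT0, map_sub, hJ2, map_zero, sub_neg_eq_add] at this
      exact this
    have h2 := hΦ x (J1 x)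
    have h3 : Φ (J1 x) = - J2 (Φ x) := by rw [eq_neg_iff_add_eq_zero, add_comm, h1]
    have h4 : (Φ (J1 x)).1 = - JA (Φ x).1 := congrArg Prod.fst h3
    have h5 : (Φ (J1 x)).2 = - JC (Φ x).2 := congrArg Prod.snd h3
    rw [h4, h5, map_neg, map_neg] at h2
    have h6 : DA.om x.1 (J1 x).1 = DA.om x.1 (JA x.1) := rfl
    have h7 : DB.om x.2 (J1 x).2 = DB.om x.2 (JB x.2) := rfl
    rw [h6, h7] at h2
    have i1 := nnA (Φ x).1
    have i2 := nnC (Φ x).2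
    have i3 := nnA x.1
    have i4 := nnB x.2
    refine Prod.ext ?_ ?_
    · by_contra h
      have := hA3 _ h
      linarith
    · by_contra h
      have := hB3 _ h
      linarith
  have hbij : Function.Bijective T0 :=
    ⟨hinj, (LinearMap.injective_iff_surjective_of_finrank_eq_finrank Φ.finrank_eq).1 hinj⟩
  have hT0J : ∀ x, T0 (J1 x) = J2 (T0 x) := by
    intro x
    rw [hT0, hT0, hJ1, map_sub, hJ2]
    simp [add_comm]
  have hT0g : ∀ g x, T0 (DA.rho g x.1, DB.rho g x.2) = (DA.rho g (T0 x).1, DC.rho g (T0 x).2) := by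
    intro g x
    have h1 : J1 (DA.rho g x.1, DB.rho g x.2) = (DA.rho g (J1 x).1, DB.rho g (J1 x).2) :=
      Prod.ext (hA4 _ _) (hB4 _ _)
    rw [hT0, hT0, h1, hΦg, hΦg]
    refine Prod.ext ?_ ?_
    · simp [J2, hA4]
    · simp [J2, hC4]
  let t : Option G → Option G := fun i => i.map (fun g => g⁻¹)
  let c : Option G → ℝ := fun i => i.elim (-1) (fun _ => 1)
  obtain ⟨d, hd⟩ := ic_cancel_ops t c
    (fun i => i.elim JA DA.rho) DA.P DA.symm DA.pos
    (fun i x y => by cases i <;> simp [t, c, hA5, DA.adjP])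
    (fun i => i.elim JB DB.rho) DB.P DB.symm DB.pos
    (fun i x y => by cases i <;> simp [t, c, hB5, DB.adjP])
    (fun i => i.elim JC DC.rho) DC.P DC.symm DC.pos
    (fun i x y => by cases i <;> simp [t, c, hC5, DC.adjP])
    T0 hbij (fun i x => by
      cases i with
      | none => exact hT0J x
      | some g => exact hT0g g x)
  exact ic_polar DB DC JB JC hB1 hB2 hB3 hB4 hC2 hC3 hC4 d (fun x => hd none x)
    (fun g x => hd (some g) x)

/-- restriction to an invariant symplectic subspace -/
def ICRep.res {G : Type*} [Group G] {E : Type*} [AddCommGroup E] [Module ℝ E]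
    (D : ICRep G E) (F : Submodule ℝ E) (hinv : ∀ g, ∀ x ∈ F, D.rho g x ∈ F)
    (hnd : ∀ y ∈ F, (∀ x ∈ F, D.om x y = 0) → y = 0) : ICRep G F where
  om := D.om.domRestrict₁₂ F F
  P := D.P.domRestrict₁₂ F F
  rho := fun g => (D.rho g).restrict (hinv g)
  alt := fun x y => D.alt x y
  nondeg := fun y hy => Subtype.ext (hnd y y.2 fun x hx => hy ⟨x, hx⟩)
  symm := fun x y => D.symm x y
  pos := fun x hx => D.pos x (by simpa using hx)
  adjOm := fun g x y => D.adjOm g x y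
  adjP := fun g x y => D.adjP g x y

/-- symplectic complement -/
def ICRep.perp {G : Type*} [Group G] {E : Type*} [AddCommGroup E] [Module ℝ E]
    (D : ICRep G E) (F : Submodule ℝ E) : Submodule ℝ E where
  carrier := {v | ∀ w ∈ F, D.om w v = 0}
  add_mem' := fun {a b} ha hb x hx => by simp [ha x hx, hb x hx]
  zero_mem' := fun x hx => by simp
  smul_mem' := fun c y hy x hx => by simp [hy x hx]

lemma ic_perp_compl {G : Type*} [Group G] {E : Type*} [AddCommGroup E] [Module ℝ E]
    [FiniteDimensional ℝ E] (D : ICRep G E) (F : Submodule ℝ E)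
    (hnd : ∀ y ∈ F, (∀ x ∈ F, D.om x y = 0) → y = 0) : IsCompl F (D.perp F) := by
  refine ⟨?_, ?_⟩
  · rw [Submodule.disjoint_def]
    intro x hx hx'
    exact hnd x hx hx'
  · rw [codisjoint_iff, eq_top_iff]
    intro z _
    have hinj : Function.Injective (D.om.domRestrict₁₂ F F).flip := by
      rw [injective_iff_map_eq_zero]
      intro x hx
      exact Subtype.ext (hnd x x.2 fun y hy => LinearMap.congr_fun hx ⟨y, hy⟩)
    let eq := LinearMap.linearEquivOfInjective _ hinj (Subspace.dual_finrank_eq).symm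
    let w : F := eq.symm ((D.om.flip z) ∘ₗ F.subtype)
    have hw : ∀ x ∈ F, D.om x w = D.om x z := by
      intro x hx
      have h : eq w = (D.om.flip z) ∘ₗ F.subtype := LinearEquiv.apply_symm_apply _ _
      exact LinearMap.congr_fun h ⟨x, hx⟩
    have : z = (w : E) + (z - w) := by abel
    rw [this]
    refine Submodule.add_mem_sup w.2 ?_
    intro x hx
    rw [map_sub, hw x hx, sub_self]

lemma ic_perp_inv {G : Type*} [Group G] {E : Type*} [AddCommGroup E] [Module ℝ E]
    (D : ICRep G E) (F : Submodule ℝ E) (hinv : ∀ g, ∀ x ∈ F, D.rho g x ∈ F) :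
    ∀ g, ∀ x ∈ D.perp F, D.rho g x ∈ D.perp F := by
  intro g x hx y hy
  rw [D.adjOm]
  exact hx _ (hinv _ _ hy)

lemma ic_perp_nd {G : Type*} [Group G] {E : Type*} [AddCommGroup E] [Module ℝ E]
    [FiniteDimensional ℝ E] (D : ICRep G E) (F : Submodule ℝ E)
    (hnd : ∀ y ∈ F, (∀ x ∈ F, D.om x y = 0) → y = 0) :
    ∀ y ∈ D.perp F, (∀ x ∈ D.perp F, D.om x y = 0) → y = 0 := by
  intro y hy h
  apply D.nondeg
  intro x
  have hx : x ∈ F ⊔ D.perp F := by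
    rw [(ic_perp_compl D F hnd).sup_eq_top]; trivial
  obtain ⟨a, ha, b, hb, rfl⟩ := Submodule.mem_sup.1 hx
  rw [map_add, LinearMap.add_apply, hy a ha, h b hb, add_zero]

lemma ic_om_add {G : Type*} [Group G] {E : Type*} [AddCommGroup E] [Module ℝ E]
    (D : ICRep G E) (F : Submodule ℝ E) (a b : E) (ha : a ∈ F) (hb : b ∈ F) (c d : E)
    (hc : c ∈ D.perp F) (hd : d ∈ D.perp F) :
    D.om (a + c) (b + d) = D.om a b + D.om c d := by
  have h1 : D.om a d = 0 := hd a ha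
  have h2 : D.om c b = 0 := by rw [D.alt, hc b hb, neg_zero]
  simp [h1, h2]

lemma ic_final {G : Type*} [Group G] {E : Type*} [AddCommGroup E] [Module ℝ E]
    [FiniteDimensional ℝ E] (D : ICRep G E) (Fi Fo : Submodule ℝ E)
    (hFiInv : ∀ g, ∀ x ∈ Fi, D.rho g x ∈ Fi)
    (hFoInv : ∀ g, ∀ x ∈ Fo, D.rho g x ∈ Fo)
    (hFiNd : ∀ y ∈ Fi, (∀ x ∈ Fi, D.om x y = 0) → y = 0)
    (hFoNd : ∀ y ∈ Fo, (∀ x ∈ Fo, D.om x y = 0) → y = 0)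
    (hdim : Module.finrank ℝ Fi = Module.finrank ℝ Fo)
    (V : E →ₗ[ℝ] E) (hVmap : ∀ x ∈ Fi, V x ∈ Fo)
    (hVequiv : ∀ g, ∀ x ∈ Fi, V (D.rho g x) = D.rho g (V x))
    (hVsymp : ∀ x ∈ Fi, ∀ y ∈ Fi, D.om (V x) (V y) = D.om x y) :
    ∃ W : E →ₗ[ℝ] E, (∀ x y, D.om (W x) (W y) = D.om x y) ∧
      (∀ g x, W (D.rho g x) = D.rho g (W x)) ∧ ∀ x ∈ Fi, W x = V x := by
  have ci := ic_perp_compl D Fi hFiNd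
  have co := ic_perp_compl D Fo hFoNd
  let v0 : Fi →ₗ[ℝ] Fo := V.restrict hVmap
  have hv0 : Function.Injective v0 := by
    rw [injective_iff_map_eq_zero]
    intro x hx
    have hx' : V x = 0 := congrArg Subtype.val hx
    refine Subtype.ext (hFiNd x x.2 fun y hy => ?_)
    rw [← hVsymp y hy x x.2, hx', map_zero]
  let v : Fi ≃ₗ[ℝ] Fo := LinearMap.linearEquivOfInjective v0 hv0 hdim
  have hv : ∀ x, (v x : E) = V x := fun _ => rfl
  let ei := Submodule.prodEquivOfIsCompl Fi (D.perp Fi) ci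
  let eo := Submodule.prodEquivOfIsCompl Fo (D.perp Fo) co
  have hei : ∀ x, ei x = x.1 + x.2 := fun x => Submodule.coe_prodEquivOfIsCompl' _ _ ci x
  have heo : ∀ x, eo x = x.1 + x.2 := fun x => Submodule.coe_prodEquivOfIsCompl' _ _ co x
  let ev : (Fi × D.perp Fo) ≃ₗ[ℝ] E :=
    (LinearEquiv.prodCongr v (LinearEquiv.refl ℝ (D.perp Fo))) ≪≫ₗ eo
  have hev : ∀ x, ev x = V x.1 + x.2 := fun x => heo _
  let Φ : (Fi × D.perp Fi) ≃ₗ[ℝ] (Fi × D.perp Fo) := ei ≪≫ₗ ev.symm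
  have hΦe : ∀ x, V (Φ x).1 + (Φ x).2 = (x.1 : E) + x.2 := by
    intro x
    rw [← hev, ← hei]
    exact ev.apply_symm_apply _
  let DA := D.res Fi hFiInv hFiNd
  let DB := D.res (D.perp Fi) (ic_perp_inv D Fi hFiInv) (ic_perp_nd D Fi hFiNd)
  let DC := D.res (D.perp Fo) (ic_perp_inv D Fo hFoInv) (ic_perp_nd D Fo hFoNd)
  obtain ⟨ψ, hψ, hψg⟩ := ic_main DA DB DC Φ
    (by
      intro x y
      have h1 := ic_om_add D Fi x.1 y.1 x.1.2 y.1.2 x.2 y.2 x.2.2 y.2.2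
      have h2 := ic_om_add D Fo _ _ (hVmap _ (Φ x).1.2) (hVmap _ (Φ y).1.2) (Φ x).2 (Φ y).2
        (Φ x).2.2 (Φ y).2.2
      rw [hΦe, hΦe, h1, hVsymp _ (Φ x).1.2 _ (Φ y).1.2] at h2
      exact h2.symm)
    (by
      intro g x
      apply ev.injective
      rw [hev, hev, hΦe]
      change D.rho g x.1 + D.rho g x.2 = V (D.rho g (Φ x).1) + D.rho g (Φ x).2
      rw [hVequiv _ _ (Φ x).1.2, ← map_add, ← map_add, hΦe])
  have hψ' : ∀ x y, D.om (ψ x) (ψ y) = D.om x y := hψ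
  have hψg' : ∀ g (x : D.perp Fi), ∀ h, (ψ ⟨D.rho g x, h⟩ : E) = D.rho g (ψ x) :=
    fun g x h => congrArg Subtype.val (hψg g x)
  let W : E →ₗ[ℝ] E := ev.toLinearMap ∘ₗ (LinearMap.id.prodMap ψ) ∘ₗ ei.symm.toLinearMap
  have hW : ∀ x, W (ei x) = V x.1 + ψ x.2 := by
    intro x
    change ev ((LinearMap.id.prodMap ψ) (ei.symm (ei x))) = _
    rw [ei.symm_apply_apply, hev]
    rfl
  refine ⟨W, fun x y => ?_, fun g x => ?_, fun x hx => ?_⟩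
  · obtain ⟨x, rfl⟩ := ei.surjective x
    obtain ⟨y, rfl⟩ := ei.surjective y
    rw [hW, hW, hei, hei, ic_om_add D Fi x.1 y.1 x.1.2 y.1.2 x.2 y.2 x.2.2 y.2.2,
      ic_om_add D Fo _ _ (hVmap _ x.1.2) (hVmap _ y.1.2) _ _ (ψ x.2).2 (ψ y.2).2,
      hVsymp _ x.1.2 _ y.1.2, hψ']
  · obtain ⟨x, rfl⟩ := ei.surjective x
    have h1 : D.rho g (ei x) = ei (⟨D.rho g x.1, hFiInv g _ x.1.2⟩,
        ⟨D.rho g x.2, ic_perp_inv D Fi hFiInv g _ x.2.2⟩) := by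
      rw [hei, hei, map_add]
    rw [h1, hW, hW, map_add, hψg', hVequiv _ _ x.1.2]
  · have h1 : x = ei (⟨x, hx⟩, 0) := by rw [hei]; simp
    conv_lhs => rw [h1]
    rw [hW]
    simp

lemma ic_omega_sq (n : ℕ) : OmegaN n * OmegaN n = -1 := by
  have h : Omega1 * Omega1 = -1 := by
    ext i j; fin_cases i <;> fin_cases j <;> simp [Omega1]
  rw [OmegaN, ← Matrix.blockDiagonal_mul, h]
  have := Matrix.blockDiagonal_neg (fun _ : Fin n => (1 : Matrix (Fin 2) (Fin 2) ℝ))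
  rw [← Matrix.blockDiagonal_one]
  exact this

lemma ic_omega_transpose (n : ℕ) : (OmegaN n)ᵀ = - OmegaN n := by
  have h : Omega1ᵀ = -Omega1 := by
    ext i j; fin_cases i <;> fin_cases j <;> simp [Omega1]
  rw [OmegaN, Matrix.blockDiagonal_transpose, h, ← Matrix.blockDiagonal_neg]
  rfl

lemma ic_posDef (n : ℕ) (σ : Matrix (Fin 2 × Fin n) (Fin 2 × Fin n) ℝ)
    (hσsymm : σ.IsSymm)
    (hσunc : (σ.map (Complex.ofReal : ℝ → ℂ) +
        Complex.I • (OmegaN n).map (Complex.ofReal : ℝ → ℂ)).PosSemidef) : σ.PosDef := by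
  have hΩ0 : ∀ x, x ⬝ᵥ (OmegaN n) *ᵥ x = 0 := by
    intro x
    have : x ⬝ᵥ (OmegaN n) *ᵥ x = - (x ⬝ᵥ (OmegaN n) *ᵥ x) := by
      conv_lhs => rw [Matrix.dotProduct_mulVec, ← Matrix.mulVec_transpose, ic_omega_transpose,
        dotProduct_comm]
      simp [Matrix.neg_mulVec]
    linarith
  have hmv : ∀ (A : Matrix (Fin 2 × Fin n) (Fin 2 × Fin n) ℝ) (x : Fin 2 × Fin n → ℝ),
      A.map (Complex.ofReal : ℝ → ℂ) *ᵥ (fun i => (x i : ℂ)) = fun i => ((A *ᵥ x) i : ℂ) := by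
    intro A x
    ext i
    simp [Matrix.mulVec, dotProduct]
  have hdp : ∀ (x y : Fin 2 × Fin n → ℝ),
      (fun i => (x i : ℂ)) ⬝ᵥ (fun i => (y i : ℂ)) = ((x ⬝ᵥ y : ℝ) : ℂ) := by
    intro x y
    simp [dotProduct]
  have hstar : ∀ (x : Fin 2 × Fin n → ℝ), star (fun i => (x i : ℂ)) = fun i => (x i : ℂ) := by
    intro x; ext i; simp
  have hq : ∀ x : Fin 2 × Fin n → ℝ, star (fun i => (x i : ℂ)) ⬝ᵥ
      ((σ.map (Complex.ofReal : ℝ → ℂ) +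
        Complex.I • (OmegaN n).map (Complex.ofReal : ℝ → ℂ)) *ᵥ (fun i => (x i : ℂ)))
      = ((x ⬝ᵥ σ *ᵥ x : ℝ) : ℂ) := by
    intro x
    rw [hstar, Matrix.add_mulVec, Matrix.smul_mulVec, hmv, hmv, dotProduct_add, dotProduct_smul,
      hdp, hdp, hΩ0]
    simp
  refine Matrix.PosDef.of_dotProduct_mulVec_pos ?_ fun x hx => ?_
  · rw [Matrix.IsHermitian, Matrix.conjTranspose_eq_transpose_of_trivial]; exact hσsymm
  · rw [star_trivial]
    have h0 := hσunc.dotProduct_mulVec_nonneg (fun i => (x i : ℂ))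
    rw [hq] at h0
    have h0' : 0 ≤ x ⬝ᵥ σ *ᵥ x := by exact_mod_cast h0
    refine lt_of_le_of_ne h0' fun h => hx ?_
    have h1 := (hσunc.dotProduct_mulVec_zero_iff (fun i => (x i : ℂ))).1 (by rw [hq, ← h]; simp)
    rw [Matrix.add_mulVec, Matrix.smul_mulVec, hmv, hmv] at h1
    have h2 : (OmegaN n) *ᵥ x = 0 := by
      ext i
      have := congrArg Complex.im (congrFun h1 i)
      simpa using this
    have h3 : (OmegaN n * OmegaN n) *ᵥ x = 0 := by
      rw [← Matrix.mulVec_mulVec, h2, Matrix.mulVec_zero]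
    rw [ic_omega_sq] at h3
    simpa [Matrix.neg_mulVec] using h3

/-- Lemma F.3 (completion of a `G`-invariant symplectic intertwiner): a `G`-equivariant,
symplectic-form-preserving linear map between invariant symplectic subspaces of equal
dimension extends to a global `G`-invariant symplectic matrix. -/
theorem intertwiner_completion (n : ℕ) {G : Type} [Group G]
    (S : G → Matrix (Fin 2 × Fin n) (Fin 2 × Fin n) ℝ)
    (hS1 : S 1 = 1) (hSmul : ∀ g h : G, S (g * h) = S g * S h)
    (hSsymp : ∀ g, IsSymplectic (S g))
    (σ : Matrix (Fin 2 × Fin n) (Fin 2 × Fin n) ℝ)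
    (hσsymm : σ.IsSymm)
    (hσunc : (σ.map (Complex.ofReal : ℝ → ℂ) +
        Complex.I • (OmegaN n).map (Complex.ofReal : ℝ → ℂ)).PosSemidef)
    (hσinv : ∀ g, S g * σ * (S g)ᵀ = σ)
    (Fi Fo : Submodule ℝ ((Fin 2 × Fin n) → ℝ))
    (hFiInv : ∀ g, ∀ x ∈ Fi, (S g).mulVec x ∈ Fi)
    (hFoInv : ∀ g, ∀ x ∈ Fo, (S g).mulVec x ∈ Fo)
    (hFiNd : ∀ v ∈ Fi, (∀ w ∈ Fi, v ⬝ᵥ (OmegaN n).mulVec w = 0) → v = 0)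
    (hFoNd : ∀ v ∈ Fo, (∀ w ∈ Fo, v ⬝ᵥ (OmegaN n).mulVec w = 0) → v = 0)
    (hdim : Module.finrank ℝ Fi = Module.finrank ℝ Fo)
    (V : ((Fin 2 × Fin n) → ℝ) →ₗ[ℝ] ((Fin 2 × Fin n) → ℝ))
    (hVmap : ∀ x ∈ Fi, V x ∈ Fo)
    (hVequiv : ∀ g, ∀ x ∈ Fi, V ((S g).mulVec x) = (S g).mulVec (V x))
    (hVsymp : ∀ x ∈ Fi, ∀ y ∈ Fi, (V x) ⬝ᵥ (OmegaN n).mulVec (V y) = x ⬝ᵥ (OmegaN n).mulVec y) :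
    ∃ W : Matrix (Fin 2 × Fin n) (Fin 2 × Fin n) ℝ,
      IsSymplectic W ∧ (∀ g, W * S g = S g * W) ∧ ∀ x ∈ Fi, W.mulVec x = V x := by
  have hpd := ic_posDef n σ hσsymm hσunc
  have hT := ic_omega_transpose n
  have hsq := ic_omega_sq n
  have hinvS : ∀ g, S g * S g⁻¹ = 1 := fun g => by rw [← hSmul, mul_inv_cancel, hS1]
  have hinvT : ∀ g, (S g)ᵀ * (S g⁻¹)ᵀ = 1 := fun g => by
    rw [← Matrix.transpose_mul, ← hSmul, inv_mul_cancel, hS1, Matrix.transpose_one]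
  have hΩS : ∀ g, OmegaN n * S g = (S g⁻¹)ᵀ * OmegaN n := by
    intro g
    have h1 : S g * OmegaN n = OmegaN n * (S g⁻¹)ᵀ := by
      have h := hSsymp g
      unfold IsSymplectic at h
      calc S g * OmegaN n = S g * OmegaN n * ((S g)ᵀ * (S g⁻¹)ᵀ) := by rw [hinvT, mul_one]
        _ = (S g * OmegaN n * (S g)ᵀ) * (S g⁻¹)ᵀ := by simp only [mul_assoc]
        _ = _ := by rw [h]
    have h2 : OmegaN n * (S g * OmegaN n) * OmegaN n
        = OmegaN n * (OmegaN n * (S g⁻¹)ᵀ) * OmegaN n := by rw [h1]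
    have h3 : OmegaN n * (S g * OmegaN n) * OmegaN n
        = OmegaN n * S g * (OmegaN n * OmegaN n) := by simp only [mul_assoc]
    have h4 : OmegaN n * (OmegaN n * (S g⁻¹)ᵀ) * OmegaN n
        = (OmegaN n * OmegaN n) * ((S g⁻¹)ᵀ * OmegaN n) := by simp only [mul_assoc]
    rw [h3, h4, hsq] at h2
    simpa using h2
  have hdet : IsUnit σ.det := (Matrix.isUnit_iff_isUnit_det σ).1 hpd.isUnit
  have hPS : ∀ g, σ⁻¹ * S g = (S g⁻¹)ᵀ * σ⁻¹ := by
    intro g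
    have h1 : S g * σ = σ * (S g⁻¹)ᵀ := by
      calc S g * σ = S g * σ * ((S g)ᵀ * (S g⁻¹)ᵀ) := by rw [hinvT, mul_one]
        _ = (S g * σ * (S g)ᵀ) * (S g⁻¹)ᵀ := by simp only [mul_assoc]
        _ = _ := by rw [hσinv g]
    calc σ⁻¹ * S g = σ⁻¹ * (S g * σ) * σ⁻¹ := by
          rw [mul_assoc, mul_assoc, Matrix.mul_nonsing_inv _ hdet, mul_one]
      _ = (σ⁻¹ * σ) * ((S g⁻¹)ᵀ * σ⁻¹) := by rw [h1]; simp only [mul_assoc]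
      _ = _ := by rw [Matrix.nonsing_inv_mul _ hdet, one_mul]
  have hadj : ∀ (A B C : Matrix (Fin 2 × Fin n) (Fin 2 × Fin n) ℝ), A * B = Cᵀ * A →
      ∀ x y, x ⬝ᵥ A *ᵥ (B *ᵥ y) = (C *ᵥ x) ⬝ᵥ A *ᵥ y := by
    intro A B C h x y
    rw [Matrix.mulVec_mulVec, h, ← Matrix.mulVec_mulVec, Matrix.dotProduct_mulVec,
      Matrix.vecMul_transpose]
  have hskew : ∀ x y, x ⬝ᵥ (OmegaN n) *ᵥ y = - (y ⬝ᵥ (OmegaN n) *ᵥ x) := by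
    intro x y
    rw [Matrix.dotProduct_mulVec, ← Matrix.mulVec_transpose, hT, dotProduct_comm,
      Matrix.neg_mulVec, dotProduct_neg]
  have hΩnd : ∀ y, (∀ x, x ⬝ᵥ (OmegaN n) *ᵥ y = 0) → y = 0 := by
    intro y hy
    have h2 : (OmegaN n) *ᵥ y = 0 := dotProduct_self_eq_zero.1 (hy _)
    have h3 : (OmegaN n * OmegaN n) *ᵥ y = 0 := by
      rw [← Matrix.mulVec_mulVec, h2, Matrix.mulVec_zero]
    rw [hsq] at h3
    simpa [Matrix.neg_mulVec] using h3
  let D : ICRep G ((Fin 2 × Fin n) → ℝ) :=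
    { om := Matrix.toLinearMap₂' ℝ (OmegaN n)
      P := Matrix.toLinearMap₂' ℝ σ⁻¹
      rho := fun g => Matrix.toLin' (S g)
      alt := fun x y => by
        simp only [Matrix.toLinearMap₂'_apply']
        exact hskew x y
      nondeg := fun y hy => by
        simp only [Matrix.toLinearMap₂'_apply'] at hy
        exact hΩnd y hy
      symm := fun x y => by
        simp only [Matrix.toLinearMap₂'_apply']
        rw [Matrix.dotProduct_mulVec, ← Matrix.mulVec_transpose, Matrix.transpose_nonsing_inv,
          hσsymm.eq, dotProduct_comm]
      pos := fun x hx => by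
        simp only [Matrix.toLinearMap₂'_apply']
        simpa using hpd.inv.dotProduct_mulVec_pos hx
      adjOm := fun g x y => by
        simp only [Matrix.toLinearMap₂'_apply', Matrix.toLin'_apply]
        exact hadj _ _ _ (hΩS g) x y
      adjP := fun g x y => by
        simp only [Matrix.toLinearMap₂'_apply', Matrix.toLin'_apply]
        exact hadj _ _ _ (hPS g) x y }
  have hom : ∀ x y, D.om x y = x ⬝ᵥ (OmegaN n) *ᵥ y := fun x y =>
    Matrix.toLinearMap₂'_apply' _ x y
  have hrho : ∀ g x, D.rho g x = S g *ᵥ x := fun g x => Matrix.toLin'_apply _ _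
  obtain ⟨W, hW1, hW2, hW3⟩ := ic_final D Fi Fo hFiInv hFoInv
    (fun y hy h => hFiNd y hy fun w hw => by rw [hskew, ← hom, h w hw, neg_zero])
    (fun y hy h => hFoNd y hy fun w hw => by rw [hskew, ← hom, h w hw, neg_zero])
    hdim V hVmap hVequiv
    (fun x hx y hy => by rw [hom, hom]; exact hVsymp x hx y hy)
  have hWm : ∀ x, (LinearMap.toMatrix' W) *ᵥ x = W x := fun x => by
    rw [← Matrix.toLin'_apply, Matrix.toLin'_toMatrix']
  refine ⟨LinearMap.toMatrix' W, ?_, fun g => ?_, fun x hx => ?_⟩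
  · set w := LinearMap.toMatrix' W with hw
    have h1 : wᵀ * OmegaN n * w = OmegaN n := by
      apply Matrix.toLin'.injective
      refine LinearMap.ext fun y => ?_
      refine dotProduct_eq _ _ fun x => ?_
      have h := hW1 x y
      rw [hom, hom, ← hWm, ← hWm] at h
      rw [dotProduct_comm, dotProduct_comm _ x, Matrix.toLin'_apply, Matrix.toLin'_apply, ← h,
        ← Matrix.mulVec_mulVec, ← Matrix.mulVec_mulVec, Matrix.dotProduct_mulVec x wᵀ,
        Matrix.vecMul_transpose]
    have h2 : (-(OmegaN n * wᵀ * OmegaN n)) * w = 1 := by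
      calc (-(OmegaN n * wᵀ * OmegaN n)) * w = -(OmegaN n * (wᵀ * OmegaN n * w)) := by
            simp only [neg_mul, mul_assoc]
        _ = 1 := by rw [h1, hsq, neg_neg]
    have h3 := mul_eq_one_comm.1 h2
    unfold IsSymplectic
    have h4 : w * OmegaN n * wᵀ * OmegaN n = -1 := by
      rw [← h3]; simp only [mul_neg, neg_neg, mul_assoc]
    calc w * OmegaN n * wᵀ = -((w * OmegaN n * wᵀ) * (OmegaN n * OmegaN n)) := by
          rw [hsq]; simp
      _ = -((w * OmegaN n * wᵀ * OmegaN n) * OmegaN n) := by simp only [mul_assoc]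
      _ = OmegaN n := by rw [h4]; simp
  · apply Matrix.toLin'.injective
    refine LinearMap.ext fun x => ?_
    rw [Matrix.toLin'_apply, Matrix.toLin'_apply, ← Matrix.mulVec_mulVec, ← Matrix.mulVec_mulVec,
      hWm, hWm, ← hrho, ← hrho]
    exact hW2 g x
  · rw [hWm]; exact hW3 x hx
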